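/- Let X and Y be topological spaces such that Y is compact, Hausdorff and totally disconnected, and let q : X → Y be a surjective local homeomorphism. Then q admits a continuous section, i.e., there exists a continuous map t : Y → X such that q(t(y)) = y for all y ∈ Y. -/

import Mathlib

/-- Continuous local sections over a clopen set and an open set can be glued to a continuous
local section over their union. -/
theorem exists_continuousOn_section_union
    {X Y : Type*} [TopologicalSpace X] [TopologicalSpace Y] (q : X → Y) {V W : Set Y}
    (hV : IsClopen V) (hW : IsOpen W) {t u : Y → X}
    (ht : ContinuousOn t V) (hqt : ∀ y ∈ V, q (t y) = y)
    (hu : ContinuousOn u W) (hqu : ∀ y ∈ W, q (u y) = y) :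
    ∃ r : Y → X, ContinuousOn r (V ∪ W) ∧ ∀ y ∈ V ∪ W, q (r y) = y := by
  classical
  refine ⟨V.piecewise t u, ?_, fun y hy => ?_⟩
  · rw [← Set.union_sdiff_self]
    refine ContinuousOn.union_of_isOpen ?_ ?_ hV.isOpen (hW.sdiff hV.isClosed)
    · exact ht.congr (Set.piecewise_eqOn V t u)
    · exact (hu.mono Set.sdiff_subset).congr
        fun y hy => Set.piecewise_eq_of_notMem V t u hy.2
  · by_cases hyV : y ∈ V
    · rw [Set.piecewise_eq_of_mem V t u hyV, hqt y hyV]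
    · rw [Set.piecewise_eq_of_notMem V t u hyV, hqu y (hy.resolve_left hyV)]


/-- Let `X` and `Y` be topological spaces such that `Y` is compact,
Hausdorff and totally disconnected, and let `q : X → Y` be a surjective local
homeomorphism.  Then `q` admits a continuous section `t : Y → X`. -/
theorem surjective_localHomeomorph_has_continuous_section
    {X Y : Type*} [TopologicalSpace X] [TopologicalSpace Y]
    [CompactSpace Y] [T2Space Y] [TotallyDisconnectedSpace Y]
    (q : X → Y) (hq : IsLocalHomeomorph q) (hsurj : Function.Surjective q) :
    ∃ t : Y → X, Continuous t ∧ ∀ y : Y, q (t y) = y := by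
  suffices h : ∃ V : Set Y, IsClopen V ∧ Set.univ ⊆ V ∧
      ∃ t : Y → X, ContinuousOn t V ∧ ∀ y ∈ V, q (t y) = y by
    obtain ⟨V, -, hV, t, ht, hqt⟩ := h
    obtain rfl := Set.univ_subset_iff.mp hV
    exact ⟨t, continuousOn_univ.mp ht, fun y => hqt y (Set.mem_univ y)⟩
  refine isCompact_univ.induction_on
    (p := fun s => ∃ V : Set Y, IsClopen V ∧ s ⊆ V ∧
      ∃ t : Y → X, ContinuousOn t V ∧ ∀ y ∈ V, q (t y) = y) ?_ ?_ ?_ ?_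
  · exact ⟨∅, isClopen_empty, subset_rfl, Function.surjInv hsurj, continuousOn_empty _,
      fun y _ => Function.surjInv_eq hsurj y⟩
  · rintro s s' hs ⟨V, hV, hsV, ht⟩
    exact ⟨V, hV, hs.trans hsV, ht⟩
  · rintro s s' ⟨V, hV, hsV, t, ht, hqt⟩ ⟨W, hW, hsW, u, hu, hqu⟩
    exact ⟨V ∪ W, hV.union hW, Set.union_subset_union hsV hsW,
      exists_continuousOn_section_union q hV hW.isOpen ht hqt hu hqu⟩
  · intro y _
    obtain ⟨x, rfl⟩ := hsurj y
    obtain ⟨e, hxe, rfl⟩ := hq x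
    obtain ⟨V, hV, hxV, hVe⟩ := compact_exists_isClopen_in_isOpen e.open_target (e.map_source hxe)
    exact ⟨V, mem_nhdsWithin_of_mem_nhds (hV.isOpen.mem_nhds hxV), V, hV, subset_rfl, e.symm,
      e.continuousOn_symm.mono hVe, fun y hy => e.right_inv (hVe hy)⟩
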